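/- The group SL₂(Z/8) has exactly 30 conjugacy classes, while the group SL₂(F₂[t]/(t³)) has exactly 24 conjugacy classes; in particular these two groups are not isomorphic and their complex group algebras are not isomorphic. -/

import Mathlib

/-- The number of related pairs of elements, as a sum over any reformulation of the relation. -/
theorem natCard_subtype_prod_eq_sum {α β : Type*} [Fintype α] [Fintype β] {r s : α → β → Prop}
    [∀ a b, Decidable (s a b)] (h : ∀ a b, r a b ↔ s a b) :
    Nat.card {p : α × β // r p.1 p.2} = ∑ a, ∑ b, if s a b then 1 else 0 := by
  simp only [h, Nat.card_eq_fintype_card, Fintype.card_subtype, Finset.card_filter,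
    Fintype.sum_prod_type]

/-- A multiplicative equivalence preserves the number of conjugacy classes. -/
theorem MulEquiv.natCard_conjClasses_eq {G H : Type*} [Group G] [Group H] (e : G ≃* H) :
    Nat.card (ConjClasses G) = Nat.card (ConjClasses H) := by
  refine Nat.card_eq_of_bijective (ConjClasses.map e.toMonoidHom)
    ⟨fun a b h => ?_, ConjClasses.map_surjective e.surjective⟩
  obtain ⟨a, rfl⟩ := ConjClasses.mk_surjective a
  obtain ⟨b, rfl⟩ := ConjClasses.mk_surjective b
  have hconj := e.symm.toMonoidHom.map_isConj (ConjClasses.mk_eq_mk_iff_isConj.mp h)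
  exact ConjClasses.mk_eq_mk_iff_isConj.mpr (by simpa using hconj)

section GroupAlgebra

variable (k G : Type*) [Field k] [Group G]

variable {k G} in
/-- An element of a group algebra is central iff its coefficients form a class function. -/
theorem MonoidAlgebra.mem_center_iff_coeff {f : MonoidAlgebra k G} :
    f ∈ Subalgebra.center k (MonoidAlgebra k G) ↔
      ∀ x y : G, IsConj x y → f.coeff x = f.coeff y := by
  rw [Subalgebra.mem_center_iff]
  constructor
  · intro h x y hxy
    obtain ⟨c, rfl⟩ := isConj_iff.mp hxy
    have := congrArg (fun p : MonoidAlgebra k G => p.coeff (c * x)) (h (single c 1))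
    simpa using this
  · intro h b
    induction b using MonoidAlgebra.induction_linear with
    | zero => simp
    | add p q hp hq => rw [add_mul, mul_add, hp, hq]
    | single g r =>
      ext x
      rw [coeff_single_mul_apply, coeff_mul_single_apply, mul_comm,
        h (g⁻¹ * x) (x * g⁻¹) (isConj_iff.mpr ⟨g, by group⟩)]

/-- The centre of the group algebra of a finite group consists of the class functions. -/
noncomputable def MonoidAlgebra.centerEquiv [Finite G] :
    Subalgebra.center k (MonoidAlgebra k G) ≃ₗ[k] (ConjClasses G → k) where
  toFun f := Quotient.lift f.1.coeff fun x y h => mem_center_iff_coeff.mp f.2 x y h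
  invFun φ := ⟨.ofCoeff (Finsupp.equivFunOnFinite.symm (φ ∘ ConjClasses.mk)),
    mem_center_iff_coeff.mpr fun x y h => by
      simp [ConjClasses.mk_eq_mk_iff_isConj.mpr h]⟩
  map_add' f g := by
    ext x
    induction x using Quotient.inductionOn
    rfl
  map_smul' r f := by
    ext x
    induction x using Quotient.inductionOn
    rfl
  left_inv f := by
    ext x
    rfl
  right_inv φ := by
    ext x
    induction x using Quotient.inductionOn
    rfl

variable {k G} in
/-- Finite groups with isomorphic group algebras have equally many conjugacy classes. -/
theorem AlgEquiv.natCard_conjClasses_eq {H : Type*} [Group H] [Finite G] [Finite H]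
    (e : MonoidAlgebra k G ≃ₐ[k] MonoidAlgebra k H) :
    Nat.card (ConjClasses G) = Nat.card (ConjClasses H) := by
  have hmap : (Subalgebra.center k (MonoidAlgebra k G)).toSubmodule.map
      (e.toLinearEquiv : MonoidAlgebra k G →ₗ[k] MonoidAlgebra k H) =
      (Subalgebra.center k (MonoidAlgebra k H)).toSubmodule := by
    ext y
    simp only [Submodule.mem_map, Subalgebra.mem_toSubmodule, Subalgebra.mem_center_iff]
    constructor
    · rintro ⟨x, hx, rfl⟩ b
      simpa using congrArg e (hx (e.symm b))
    · intro h
      refine ⟨e.symm y, fun b => ?_, by simp⟩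
      simpa using congrArg e.symm (h (e b))
  have := Fintype.ofFinite (ConjClasses G)
  have := Fintype.ofFinite (ConjClasses H)
  have hG := (MonoidAlgebra.centerEquiv k G).finrank_eq
  have hH := (MonoidAlgebra.centerEquiv k H).finrank_eq
  have he := e.toLinearEquiv.finrank_map_eq (Subalgebra.center k (MonoidAlgebra k G)).toSubmodule
  rw [hmap] at he
  rw [Module.finrank_fintype_fun_eq_card, ← Nat.card_eq_fintype_card] at hG hH
  rw [← hG, ← hH]
  exact he.symm

end GroupAlgebra

namespace Matrix.SpecialLinearGroup

/-- A ring isomorphism `R ≃+* S` induces `SLₙ(R) ≃* SLₙ(S)`. -/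
def mulEquivOfRingEquiv (n : Type*) [DecidableEq n] [Fintype n] {R S : Type*} [CommRing R]
    [CommRing S] (e : R ≃+* S) : SpecialLinearGroup n R ≃* SpecialLinearGroup n S :=
  (map e.toRingHom).toMulEquiv (map e.symm.toRingHom) (by ext; simp) (by ext; simp)

variable {R : Type*} [CommRing R]

theorem commute_fin_two_iff {x b c d y p q e : R} :
    Commute !![d + x, b; c, d] !![e + y, p; q, e] ↔
      b * q = p * c ∧ x * p = y * b ∧ x * q = y * c := by
  simp only [commute_iff_eq, mul_fin_two, EmbeddingLike.apply_eq_iff_eq, vecCons_inj, and_true]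
  constructor
  · rintro ⟨⟨h₁, h₂⟩, h₃, -⟩
    exact ⟨by linear_combination h₁, by linear_combination h₂, by linear_combination -h₃⟩
  · rintro ⟨h₁, h₂, h₃⟩
    exact ⟨⟨by linear_combination h₁, by linear_combination h₂⟩, by linear_combination -h₃,
      by linear_combination -h₁⟩

variable [Fintype R] [DecidableEq R]

/-- Summation over `SL₂(R)`, with matrices written as `!![d + x, b; c, d]`. -/
theorem sum_fin_two (F : Matrix (Fin 2) (Fin 2) R → ℕ) :
    ∑ g : SpecialLinearGroup (Fin 2) R, F g =
      ∑ b, ∑ c, ∑ x, ∑ d, if (d + x) * d - b * c = 1 then F !![d + x, b; c, d] else 0 := by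
  let e : R × R × R × R ≃ Matrix (Fin 2) (Fin 2) R :=
    { toFun v := !![v.2.2.2 + v.2.2.1, v.1; v.2.1, v.2.2.2]
      invFun A := (A 0 1, A 1 0, A 0 0 - A 1 1, A 1 1)
      left_inv v := by simp
      right_inv A := by
        ext i j
        fin_cases i <;> fin_cases j <;> simp }
  calc ∑ g : SpecialLinearGroup (Fin 2) R, F g
      = ∑ A : Matrix (Fin 2) (Fin 2) R with A.det = 1, F A :=
        (Finset.sum_subtype _ (by simp) F).symm
    _ = ∑ v, if (e v).det = 1 then F (e v) else 0 := by
        rw [Finset.sum_filter, e.sum_comp fun A => if A.det = 1 then F A else 0]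
    _ = _ := by simp [Fintype.sum_prod_type, det_fin_two, e]

variable (R) in
theorem natCard_fin_two : Nat.card (SpecialLinearGroup (Fin 2) R) =
    ∑ b : R, ∑ c, ∑ x, ∑ d, if (d + x) * d - b * c = 1 then 1 else 0 := by
  rw [← sum_fin_two fun _ => 1]
  simp

variable (R) in
theorem natCard_commute_fin_two :
    Nat.card {p : SpecialLinearGroup (Fin 2) R × SpecialLinearGroup (Fin 2) R //
      Commute p.1 p.2} =
    ∑ b : R, ∑ c, ∑ x, ∑ d, if (d + x) * d - b * c = 1 then
      ∑ p, ∑ q, if b * q = p * c then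
        ∑ y, if x * p = y * b ∧ x * q = y * c then
          ∑ e, if (e + y) * e - p * q = 1 then 1 else 0
        else 0
      else 0
    else 0 := by
  classical
  have hcomm (g h : SpecialLinearGroup (Fin 2) R) :
      Commute g h ↔ Commute (g : Matrix (Fin 2) (Fin 2) R) h := Subtype.ext_iff
  have hcentralizer (b c x d : R) :
      (∑ h : SpecialLinearGroup (Fin 2) R,
        if Commute !![d + x, b; c, d] (h : Matrix (Fin 2) (Fin 2) R) then 1 else 0) =
      ∑ p, ∑ q, if b * q = p * c then
        ∑ y, if x * p = y * b ∧ x * q = y * c then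
          ∑ e, if (e + y) * e - p * q = 1 then 1 else 0
        else 0
      else 0 := by
    refine (sum_fin_two fun B => if Commute !![d + x, b; c, d] B then 1 else 0).trans ?_
    simp only [commute_fin_two_iff]
    refine Finset.sum_congr rfl fun p _ => Finset.sum_congr rfl fun q _ => ?_
    by_cases h : b * q = p * c
    · simp only [h, true_and, if_true]
      refine Finset.sum_congr rfl fun y _ => ?_
      split_ifs <;> simp
    · simp [h]
  rw [natCard_subtype_prod_eq_sum hcomm]
  rw [sum_fin_two fun A => ∑ h : SpecialLinearGroup (Fin 2) R,
    if Commute A (h : Matrix (Fin 2) (Fin 2) R) then 1 else 0]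
  simp only [hcentralizer]

end Matrix.SpecialLinearGroup

/-- Polynomials over `R` truncated at degree three, as triples of coefficients. -/
@[ext] structure TruncatedPolynomial (R : Type*) where
  c₀ : R
  c₁ : R
  c₂ : R
deriving DecidableEq, Fintype

namespace TruncatedPolynomial

variable {R : Type*} [CommRing R]

instance : Zero (TruncatedPolynomial R) := ⟨⟨0, 0, 0⟩⟩
instance : One (TruncatedPolynomial R) := ⟨⟨1, 0, 0⟩⟩
instance : Add (TruncatedPolynomial R) := ⟨fun f g => ⟨f.c₀ + g.c₀, f.c₁ + g.c₁, f.c₂ + g.c₂⟩⟩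
instance : Neg (TruncatedPolynomial R) := ⟨fun f => ⟨-f.c₀, -f.c₁, -f.c₂⟩⟩
instance : Mul (TruncatedPolynomial R) :=
  ⟨fun f g => ⟨f.c₀ * g.c₀, f.c₀ * g.c₁ + f.c₁ * g.c₀, f.c₀ * g.c₂ + f.c₁ * g.c₁ + f.c₂ * g.c₀⟩⟩

theorem zero_def : (0 : TruncatedPolynomial R) = ⟨0, 0, 0⟩ := rfl

theorem one_def : (1 : TruncatedPolynomial R) = ⟨1, 0, 0⟩ := rfl

theorem add_def (f g : TruncatedPolynomial R) :
    f + g = ⟨f.c₀ + g.c₀, f.c₁ + g.c₁, f.c₂ + g.c₂⟩ := rfl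

theorem neg_def (f : TruncatedPolynomial R) : -f = ⟨-f.c₀, -f.c₁, -f.c₂⟩ := rfl

theorem mul_def (f g : TruncatedPolynomial R) :
    f * g = ⟨f.c₀ * g.c₀, f.c₀ * g.c₁ + f.c₁ * g.c₀,
      f.c₀ * g.c₂ + f.c₁ * g.c₁ + f.c₂ * g.c₀⟩ := rfl

instance : CommRing (TruncatedPolynomial R) where
  add_assoc _ _ _ := by simp [add_def, add_assoc]
  zero_add := by simp [add_def, zero_def]
  add_zero := by simp [add_def, zero_def]
  add_comm _ _ := by simp [add_def, add_comm]
  mul_assoc _ _ _ := by ext <;> simp only [mul_def] <;> ring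
  mul_comm _ _ := by ext <;> simp only [mul_def] <;> ring
  one_mul := by simp [mul_def, one_def]
  mul_one := by simp [mul_def, one_def]
  left_distrib _ _ _ := by ext <;> simp only [mul_def, add_def] <;> ring
  right_distrib _ _ _ := by ext <;> simp only [mul_def, add_def] <;> ring
  zero_mul := by simp [mul_def, zero_def]
  mul_zero := by simp [mul_def, zero_def]
  neg_add_cancel := by simp [add_def, neg_def, zero_def]
  nsmul := nsmulRec
  zsmul := zsmulRec

open Polynomial

/-- Truncation of a polynomial at degree three. -/
def ofPolynomial : R[X] →+* TruncatedPolynomial R where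
  toFun f := ⟨f.coeff 0, f.coeff 1, f.coeff 2⟩
  map_zero' := by simp [zero_def]
  map_one' := by simp [one_def, coeff_one]
  map_add' f g := by simp [add_def]
  map_mul' f g := by
    simp [mul_def, coeff_mul, Finset.Nat.antidiagonal_succ, add_assoc]

theorem ofPolynomial_apply (f : R[X]) : ofPolynomial f = ⟨f.coeff 0, f.coeff 1, f.coeff 2⟩ := rfl

theorem ofPolynomial_surjective : Function.Surjective (ofPolynomial (R := R)) := fun f =>
  ⟨C f.c₀ + C f.c₁ * X + C f.c₂ * X ^ 2, by
    rw [ofPolynomial_apply]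
    simp [coeff_X, coeff_C, coeff_X_pow]⟩

theorem ker_ofPolynomial : RingHom.ker (ofPolynomial (R := R)) = Ideal.span {X ^ 3} := by
  ext f
  rw [RingHom.mem_ker, Ideal.mem_span_singleton, X_pow_dvd_iff]
  simp only [ofPolynomial_apply, zero_def, mk.injEq]
  exact ⟨fun ⟨h₀, h₁, h₂⟩ d hd => by interval_cases d <;> assumption,
    fun h => ⟨h 0 (by norm_num), h 1 (by norm_num), h 2 (by norm_num)⟩⟩

/-- Truncated polynomials form the quotient ring `R[X] / (X³)`. -/
noncomputable def quotientEquiv :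
    (R[X] ⧸ Ideal.span {(X : R[X]) ^ 3}) ≃+* TruncatedPolynomial R :=
  (Ideal.quotEquivOfEq ker_ofPolynomial.symm).trans
    (RingHom.quotientKerEquivOfSurjective ofPolynomial_surjective)

end TruncatedPolynomial

namespace Matrix.SpecialLinearGroup

theorem natCard_conjClasses_zmod_eight :
    Nat.card (ConjClasses (SpecialLinearGroup (Fin 2) (ZMod 8))) = 30 := by
  have hcard : Nat.card (SpecialLinearGroup (Fin 2) (ZMod 8)) = 384 := by
    rw [natCard_fin_two]
    decide +kernel
  have hcomm := card_comm_eq_card_conjClasses_mul_card (SpecialLinearGroup (Fin 2) (ZMod 8))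
  rw [hcard, natCard_commute_fin_two] at hcomm
  refine Nat.eq_of_mul_eq_mul_right (by norm_num : 0 < 384) (hcomm.symm.trans ?_)
  decide +kernel

theorem natCard_conjClasses_truncatedPolynomial :
    Nat.card (ConjClasses (SpecialLinearGroup (Fin 2) (TruncatedPolynomial (ZMod 2)))) = 24 := by
  have hcard : Nat.card (SpecialLinearGroup (Fin 2) (TruncatedPolynomial (ZMod 2))) = 384 := by
    rw [natCard_fin_two]
    decide +kernel
  have hcomm := card_comm_eq_card_conjClasses_mul_card
    (SpecialLinearGroup (Fin 2) (TruncatedPolynomial (ZMod 2)))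
  rw [hcard, natCard_commute_fin_two] at hcomm
  refine Nat.eq_of_mul_eq_mul_right (by norm_num : 0 < 384) (hcomm.symm.trans ?_)
  decide +kernel

end Matrix.SpecialLinearGroup

/-- `SL₂(ℤ/8)` has exactly 30 conjugacy classes, while `SL₂(𝔽₂[t]/(t³))` has exactly 24
conjugacy classes; in particular these two groups are not isomorphic and their complex
group algebras are not isomorphic. -/
theorem stmt_19 :
    Nat.card (ConjClasses (Matrix.SpecialLinearGroup (Fin 2) (ZMod 8))) = 30 ∧
    Nat.card (ConjClasses (Matrix.SpecialLinearGroup (Fin 2)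
      (Polynomial (ZMod 2) ⧸ Ideal.span {(Polynomial.X : Polynomial (ZMod 2)) ^ 3}))) = 24 ∧
    IsEmpty (Matrix.SpecialLinearGroup (Fin 2) (ZMod 8) ≃*
      Matrix.SpecialLinearGroup (Fin 2)
        (Polynomial (ZMod 2) ⧸ Ideal.span {(Polynomial.X : Polynomial (ZMod 2)) ^ 3})) ∧
    IsEmpty (MonoidAlgebra ℂ (Matrix.SpecialLinearGroup (Fin 2) (ZMod 8)) ≃ₐ[ℂ]
      MonoidAlgebra ℂ (Matrix.SpecialLinearGroup (Fin 2)
        (Polynomial (ZMod 2) ⧸ Ideal.span {(Polynomial.X : Polynomial (ZMod 2)) ^ 3}))) := by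
  let e := Matrix.SpecialLinearGroup.mulEquivOfRingEquiv (Fin 2)
    (TruncatedPolynomial.quotientEquiv (R := ZMod 2))
  have h₃₀ := Matrix.SpecialLinearGroup.natCard_conjClasses_zmod_eight
  have h₂₄ := e.natCard_conjClasses_eq.trans
    Matrix.SpecialLinearGroup.natCard_conjClasses_truncatedPolynomial
  have := Finite.of_equiv _ e.symm.toEquiv
  refine ⟨h₃₀, h₂₄, ⟨fun f => ?_⟩, ⟨fun f => ?_⟩⟩ <;>
  · have := f.natCard_conjClasses_eq
    rw [h₃₀, h₂₄] at this
    norm_num at this
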